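/- Let I = (0,a), 0 < a ≤ ∞, w a decreasing non-negative weight function on I, and let φ be an Orlicz function which is equivalent to a p-concave Orlicz function for some 1 < p < ∞. Then the class M_{φ,w} with ‖f‖_M = inf{ ε > 0 : ∫_I φ(f*/(ε w)) w ≤ 1 } is p-concave: there is a constant c > 0 such that for all f₁,…,f_n ∈ M_{φ,w} and every n ∈ ℕ, ‖ (∑_{i=1}^n |f_i|^p)^{1/p} ‖_M ≥ c ( ∑_{i=1}^n ‖f_i‖_M^p )^{1/p}. -/

import Mathlib

open MeasureTheory Set Filter Topology ENNReal

noncomputable section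

namespace OrliczRearrangement

/-- An Orlicz function: convex on `[0,∞)`, strictly increasing on `[0,∞)` and vanishing at `0`. -/
def IsOrliczFn (φ : ℝ → ℝ) : Prop :=
  ConvexOn ℝ (Set.Ici 0) φ ∧ StrictMonoOn φ (Set.Ici 0) ∧ φ 0 = 0

/-- An `N`-function: an Orlicz function with `φ(t)/t → 0` as `t → 0⁺` and `φ(t)/t → ∞`
as `t → ∞`. -/
def IsNFn (φ : ℝ → ℝ) : Prop :=
  IsOrliczFn φ ∧ Filter.Tendsto (fun t => φ t / t) (nhdsWithin 0 (Set.Ioi 0)) (nhds 0) ∧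
    Filter.Tendsto (fun t => φ t / t) Filter.atTop Filter.atTop

/-- The complementary (conjugate) function `φ*(t) = sup_{s>0} (st - φ(s))`. -/
def conjFn (φ : ℝ → ℝ) (t : ℝ) : ℝ := sSup ((fun s => s * t - φ s) '' Set.Ioi 0)

/-- The interval `I = (0,a)`, `0 < a ≤ ∞`, as a subset of `ℝ`. -/
def Ioa' (a : ℝ≥0∞) : Set ℝ := {t : ℝ | 0 < t ∧ ENNReal.ofReal t < a}

/-- Distribution function `d_f(s) = |{t ∈ (0,a) : |f(t)| > s}|`. -/
def distr (a : ℝ≥0∞) (f : ℝ → ℝ) (s : ℝ) : ℝ≥0∞ := volume {t ∈ Ioa' a | s < |f t|}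

/-- Decreasing rearrangement `f*(t) = inf{s ≥ 0 : d_f(s) ≤ t}` of `f` on `(0,a)`,
with value `∞` when no such `s` exists. -/
def decRe (a : ℝ≥0∞) (f : ℝ → ℝ) (t : ℝ) : ℝ≥0∞ :=
  sInf (ENNReal.ofReal '' {s : ℝ | 0 ≤ s ∧ distr a f s ≤ ENNReal.ofReal t})

/-- Distribution of a sequence: `d_x(s) = |{k : |x(k)| > s}|`. -/
def sdistr (x : ℕ → ℝ) (s : ℝ) : ℕ∞ := {k : ℕ | s < |x k|}.encard

/-- Decreasing rearrangement of a sequence (`0`-indexed):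
`x*(n) = inf{s > 0 : d_x(s) ≤ n}`, with value `∞` when no such `s` exists. -/
def sdecRe (x : ℕ → ℝ) (n : ℕ) : ℝ≥0∞ :=
  sInf (ENNReal.ofReal '' {s : ℝ | 0 < s ∧ sdistr x s ≤ (n : ℕ∞)})

/-- The extended-real quantity `φ(c/v)·v`, with the convention that for `v = 0` it equals
`0` if `c = 0` and `∞` if `c ≠ 0`. -/
def oterm (φ : ℝ → ℝ) (c v : ℝ) : ℝ≥0∞ :=
  if v = 0 then (if c = 0 then 0 else ∞) else ENNReal.ofReal (φ (c / v) * v)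

/-- The quantity `φ(c/v)·v` for an extended-real numerator `c`; it equals `∞` when
`c = ∞`. -/
def otermE (φ : ℝ → ℝ) (c : ℝ≥0∞) (v : ℝ) : ℝ≥0∞ :=
  if c = ∞ then ∞ else oterm φ c.toReal v

/-- The modular `M(f) = ∫_I φ(f*/w)·w`. -/
def Mmod (a : ℝ≥0∞) (φ w f : ℝ → ℝ) : ℝ≥0∞ :=
  ∫⁻ t in Ioa' a, otermE φ (decRe a f t) (w t)

/-- The functional `‖f‖_M = inf{ε > 0 : M(f/ε) ≤ 1}` (equal to `∞` if no such `ε`). -/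
def Mnorm (a : ℝ≥0∞) (φ w f : ℝ → ℝ) : ℝ≥0∞ :=
  ⨅ ε ∈ {ε : ℝ | 0 < ε ∧ Mmod a φ w (fun t => f t / ε) ≤ 1}, ENNReal.ofReal ε

/-- The class `M_{φ,w}` of measurable `f` with `M(λf) < ∞` for some `λ > 0`. -/
def Mclass (a : ℝ≥0∞) (φ w : ℝ → ℝ) : Set (ℝ → ℝ) :=
  {f | Measurable f ∧ ∃ c > 0, Mmod a φ w (fun t => c * f t) < ∞}

/-- Submajorization `v ≺ w` on `(0,a)`: `∫₀ᵗ v* ≤ ∫₀ᵗ w*` for all `t ∈ (0,a)`. -/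
def Submaj (a : ℝ≥0∞) (v w : ℝ → ℝ) : Prop :=
  ∀ t ∈ Ioa' a, ∫⁻ s in Set.Ioo 0 t, decRe a v s ≤ ∫⁻ s in Set.Ioo 0 t, decRe a w s

/-- The modular `P`, for (decreasing-rearrangement-like) `[0,∞]`-valued data `F`:
`P(F) = inf{∫_I φ(F/v)·v : v ≥ 0, v ≺ w}`. -/
def PmodE (a : ℝ≥0∞) (φ w : ℝ → ℝ) (F : ℝ → ℝ≥0∞) : ℝ≥0∞ :=
  ⨅ v ∈ {v : ℝ → ℝ | Measurable v ∧ (∀ t, 0 ≤ v t) ∧ Submaj a v w},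
    ∫⁻ t in Ioa' a, otermE φ (F t) (v t)

/-- The modular `P(f) = inf{∫_I φ(|f|/v)·v : v ≥ 0, v ≺ w}`. -/
def Pmod (a : ℝ≥0∞) (φ w f : ℝ → ℝ) : ℝ≥0∞ :=
  PmodE a φ w fun t => ENNReal.ofReal |f t|

/-- The norm of `𝓜_{φ,w}` for `[0,∞]`-valued data. -/
def PnormE (a : ℝ≥0∞) (φ w : ℝ → ℝ) (F : ℝ → ℝ≥0∞) : ℝ≥0∞ :=
  ⨅ ε ∈ {ε : ℝ | 0 < ε ∧ PmodE a φ w (fun t => F t / ENNReal.ofReal ε) ≤ 1},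
    ENNReal.ofReal ε

/-- The norm `‖f‖_𝓜 = inf{ε > 0 : P(f/ε) ≤ 1}`. -/
def Pnorm (a : ℝ≥0∞) (φ w f : ℝ → ℝ) : ℝ≥0∞ :=
  PnormE a φ w fun t => ENNReal.ofReal |f t|

/-- The space `𝓜_{φ,w}` of measurable `f` with `P(λf) < ∞` for some `λ > 0`. -/
def Pclass (a : ℝ≥0∞) (φ w : ℝ → ℝ) : Set (ℝ → ℝ) :=
  {f | Measurable f ∧ ∃ c > 0, Pmod a φ w (fun t => c * f t) < ∞}

/-- Sequence submajorization `v ≺ w`. -/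
def sSubmaj (v w : ℕ → ℝ) : Prop :=
  ∀ m : ℕ, ∑ n ∈ Finset.range m, sdecRe v n ≤ ∑ n ∈ Finset.range m, sdecRe w n

/-- Sequence modular `p` for `[0,∞]`-valued data. -/
def spmodE (φ : ℝ → ℝ) (w : ℕ → ℝ) (X : ℕ → ℝ≥0∞) : ℝ≥0∞ :=
  ⨅ v ∈ {v : ℕ → ℝ | (∀ n, 0 ≤ v n) ∧ sSubmaj v w}, ∑' n, otermE φ (X n) (v n)

/-- Sequence modular `p(x) = inf{∑ φ(|x(n)|/v(n))·v(n) : v ≥ 0, v ≺ w}`. -/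
def spmod (φ : ℝ → ℝ) (w x : ℕ → ℝ) : ℝ≥0∞ :=
  spmodE φ w fun n => ENNReal.ofReal |x n|

/-- Sequence norm for `[0,∞]`-valued data. -/
def spnormE (φ : ℝ → ℝ) (w : ℕ → ℝ) (X : ℕ → ℝ≥0∞) : ℝ≥0∞ :=
  ⨅ ε ∈ {ε : ℝ | 0 < ε ∧ spmodE φ w (fun n => X n / ENNReal.ofReal ε) ≤ 1},
    ENNReal.ofReal ε

/-- Sequence norm `‖x‖_𝔪 = inf{ε > 0 : p(x/ε) ≤ 1}`. -/
def spnorm (φ : ℝ → ℝ) (w x : ℕ → ℝ) : ℝ≥0∞ :=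
  spnormE φ w fun n => ENNReal.ofReal |x n|

/-- Dilation operator `D₂f(t) = f(t/2)`, where `f` is extended by `0` outside `(0,a)`. -/
def D2 (a : ℝ≥0∞) (f : ℝ → ℝ) : ℝ → ℝ := fun t => (Ioa' a).indicator f (t / 2)

/-- A measure preserving transformation from `S` onto `S`. -/
def MeasPresOn (σ : ℝ → ℝ) (S : Set ℝ) : Prop :=
  Set.MapsTo σ S S ∧ Set.SurjOn σ S S ∧ Measurable σ ∧
    ∀ A : Set ℝ, A ⊆ S → MeasurableSet A → volume (S ∩ σ ⁻¹' A) = volume A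

/-- Luxemburg norm of the weighted Orlicz space `L_φ(w)` on `(0,a)`. -/
def luxNorm (a : ℝ≥0∞) (φ w g : ℝ → ℝ) : ℝ≥0∞ :=
  ⨅ ε ∈ {ε : ℝ | 0 < ε ∧
      ∫⁻ t in Ioa' a, ENNReal.ofReal (φ (|g t| / ε) * w t) ≤ 1}, ENNReal.ofReal ε

/-- The Orlicz norm of `f` in `Λ_{φ*,w}`, defined by duality with the unit ball of
`L_φ(w)`: `‖f‖⁰ = sup{∫_I f° g w : g ≥ 0, ‖g‖_{L_φ(w)} ≤ 1}`. -/
def lamOnorm (a : ℝ≥0∞) (φ w f : ℝ → ℝ) : ℝ≥0∞ :=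
  ⨆ g ∈ {g : ℝ → ℝ | Measurable g ∧ (∀ t, 0 ≤ g t) ∧ luxNorm a φ w g ≤ 1},
    ∫⁻ t in Ioa' a, decRe a f t * ENNReal.ofReal (g t * w t)

/-- The Orlicz–Lorentz class `Λ_{φs,w}`: measurable `g` whose (finite) decreasing
rearrangement satisfies `∫_I φs(c·g°)·w < ∞` for some `c > 0`. -/
def LamClass (a : ℝ≥0∞) (φs w : ℝ → ℝ) : Set (ℝ → ℝ) :=
  {g | Measurable g ∧ (∀ t ∈ Ioa' a, decRe a g t < ∞) ∧
    ∃ c > 0, ∫⁻ t in Ioa' a, ENNReal.ofReal (φs (c * (decRe a g t).toReal) * w t) < ∞}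

/-- The (generalized right-continuous) inverse `φ⁻¹(y) = inf{s ≥ 0 : φ(s) ≥ y}`. -/
def phiInv (φ : ℝ → ℝ) (y : ℝ) : ℝ := sInf {s : ℝ | 0 ≤ s ∧ y ≤ φ s}

/-! ### The integrand as a layer-cake integral -/

/-- The layer-cake density of `oterm φ`: for `x, v ≥ 0` one has
`oterm φ x v = ∫⁻ y in Ioo 0 x, otermDensity φ y v`. -/
def otermDensity (φ : ℝ → ℝ) (y v : ℝ) : ℝ≥0∞ :=
  if v = 0 then ∞ else ENNReal.ofReal (derivWithin φ (Ioi (y / v)) (y / v))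

/-- An Orlicz function extended by `0` to the negative half-line. -/
structure IsExtOrlicz (φ : ℝ → ℝ) : Prop where
  convexOn : ConvexOn ℝ univ φ
  monotone : Monotone φ
  map_zero : φ 0 = 0
  pos : ∀ x, 0 < x → 0 < φ x

lemma IsOrliczFn.isExtOrlicz {φ : ℝ → ℝ} (hφ : IsOrliczFn φ) :
    IsExtOrlicz (fun x => φ (max x 0)) := by
  obtain ⟨hc, hm, h0⟩ := hφ
  have hmono : Monotone fun x => φ (max x 0) := fun x y hxy =>
    hm.monotoneOn (le_max_right x 0) (le_max_right y 0) (max_le_max_right 0 hxy)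
  refine ⟨⟨convex_univ, fun x _ y _ s t hs ht hst => ?_⟩, hmono, by simpa using h0,
    fun x hx => ?_⟩
  · have h1 : max (s • x + t • y) 0 ≤ s • max x 0 + t • max y 0 := by
      simp only [smul_eq_mul]
      refine max_le ?_ (by positivity)
      gcongr <;> exact le_max_left _ _
    refine (hm.monotoneOn (mem_Ici.2 (le_max_right _ _))
      (mem_Ici.2 ((le_max_right _ _).trans h1)) h1).trans ?_
    exact hc.2 (le_max_right x 0) (le_max_right y 0) hs ht hst
  · simp only [max_eq_left hx.le]
    simpa [h0] using hm self_mem_Ici hx.le hx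

namespace IsExtOrlicz

variable {φ : ℝ → ℝ}

lemma nonneg (hφ : IsExtOrlicz φ) {x : ℝ} (hx : 0 ≤ x) : 0 ≤ φ x :=
  hφ.map_zero ▸ hφ.monotone hx

lemma monotone_rightDeriv (hφ : IsExtOrlicz φ) :
    Monotone fun x => derivWithin φ (Ioi x) x := by
  have h := hφ.convexOn.monotoneOn_rightDeriv
  rwa [interior_univ, monotoneOn_univ] at h

lemma rightDeriv_nonneg (hφ : IsExtOrlicz φ) (x : ℝ) : 0 ≤ derivWithin φ (Ioi x) x :=
  (hφ.monotone.monotoneOn _).derivWithin_nonneg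

lemma ofReal_eq_lintegral (hφ : IsExtOrlicz φ) {x v : ℝ} (hx : 0 ≤ x) (hv : 0 < v) :
    ENNReal.ofReal (φ (x / v) * v) =
      ∫⁻ y in Ioo 0 x, ENNReal.ofReal (derivWithin φ (Ioi (y / v)) (y / v)) := by
  have hint : ∀ z, IntervalIntegrable (fun y => derivWithin φ (Ioi y) y) volume 0 z := fun z =>
    hφ.monotone_rightDeriv.intervalIntegrable
  have hcont : Continuous φ :=
    continuousOn_univ.1 (hφ.convexOn.continuousOn isOpen_univ)
  have hmono : Monotone fun y => derivWithin φ (Ioi (y / v)) (y / v) := fun y z hyz =>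
    hφ.monotone_rightDeriv (by gcongr : y / v ≤ z / v)
  have hFTC : ∫ y in (0 : ℝ)..(x / v), derivWithin φ (Ioi y) y = φ (x / v) := by
    rw [intervalIntegral.integral_eq_sub_of_hasDeriv_right hcont.continuousOn
      (fun y _ => hφ.convexOn.hasDerivWithinAt_rightDeriv_of_mem_interior (by simp)) (hint _),
      hφ.map_zero, sub_zero]
  have hscale : ∫ y in (0 : ℝ)..x, derivWithin φ (Ioi (y / v)) (y / v) = φ (x / v) * v := by
    rw [intervalIntegral.integral_comp_div (fun y => derivWithin φ (Ioi y) y) hv.ne', zero_div,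
      hFTC, smul_eq_mul, mul_comm]
  rw [← hscale, intervalIntegral.integral_of_le hx, integral_Ioc_eq_integral_Ioo,
    ofReal_integral_eq_lintegral_ofReal]
  · exact (hmono.intervalIntegrable (a := 0) (b := x)).1.mono_set Ioo_subset_Ioc_self
  · exact Eventually.of_forall fun y => hφ.rightDeriv_nonneg _

lemma oterm_eq_lintegral (hφ : IsExtOrlicz φ) {x v : ℝ} (hx : 0 ≤ x) (hv : 0 ≤ v) :
    oterm φ x v = ∫⁻ y in Ioo 0 x, otermDensity φ y v := by
  rcases hv.eq_or_lt with rfl | hv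
  · rcases hx.eq_or_lt with rfl | hx
    · simp [oterm]
    · simp [oterm, otermDensity, hx.ne', hx]
  · simp only [oterm, otermDensity, hv.ne', if_false]
    exact hφ.ofReal_eq_lintegral hx hv

lemma measurable_otermDensity (hφ : IsExtOrlicz φ) :
    Measurable fun z : ℝ × ℝ => otermDensity φ z.1 z.2 := by
  refine Measurable.ite (measurable_snd (measurableSet_singleton 0)) measurable_const ?_
  exact (hφ.monotone_rightDeriv.measurable.comp
    (measurable_fst.div measurable_snd)).ennreal_ofReal

lemma measurable_oterm (hφ : IsExtOrlicz φ) :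
    Measurable fun z : ℝ × ℝ => oterm φ z.1 z.2 := by
  refine Measurable.ite (measurable_snd (measurableSet_singleton 0))
    (Measurable.ite (measurable_fst (measurableSet_singleton 0)) measurable_const
      measurable_const) ?_
  exact ((hφ.monotone.measurable.comp
    (measurable_fst.div measurable_snd)).mul measurable_snd).ennreal_ofReal

lemma otermDensity_anti (hφ : IsExtOrlicz φ) {y v v' : ℝ} (hy : 0 ≤ y) (hv : 0 ≤ v)
    (hvv' : v ≤ v') : otermDensity φ y v' ≤ otermDensity φ y v := by
  rcases hv.eq_or_lt with rfl | hv
  · simp [otermDensity]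
  · simp only [otermDensity, hv.ne', (hv.trans_le hvv').ne', if_false]
    exact ENNReal.ofReal_le_ofReal (hφ.monotone_rightDeriv (by gcongr))

lemma oterm_mono (hφ : IsExtOrlicz φ) {x x' v v' : ℝ} (hx : 0 ≤ x) (hxx' : x ≤ x')
    (hv : 0 ≤ v) (hvv' : v ≤ v') : oterm φ x v' ≤ oterm φ x' v := by
  rw [hφ.oterm_eq_lintegral hx (hv.trans hvv'), hφ.oterm_eq_lintegral (hx.trans hxx') hv]
  exact (lintegral_mono_set (Ioo_subset_Ioo_right hxx')).trans
    (setLIntegral_mono' measurableSet_Ioo fun y hy => hφ.otermDensity_anti hy.1.le hv hvv')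

lemma oterm_pos (hφ : IsExtOrlicz φ) {x v : ℝ} (hx : 0 < x) (hv : 0 ≤ v) :
    0 < oterm φ x v := by
  rcases hv.eq_or_lt with rfl | hv
  · simp [oterm, hx.ne']
  · simp only [oterm, hv.ne', if_false, ENNReal.ofReal_pos]
    exact mul_pos (hφ.pos _ (by positivity)) hv

lemma oterm_le_otermE (hφ : IsExtOrlicz φ) {x v : ℝ} {c : ℝ≥0∞} (hx : 0 ≤ x)
    (hxc : ENNReal.ofReal x ≤ c) (hv : 0 ≤ v) : oterm φ x v ≤ otermE φ c v := by
  unfold otermE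
  split_ifs with hc
  · exact le_top
  · exact hφ.oterm_mono hx ((ENNReal.ofReal_le_iff_le_toReal hc).1 hxc) hv le_rfl

end IsExtOrlicz

lemma IsExtOrlicz.otermDensity_mono {φ : ℝ → ℝ} (hφ : IsExtOrlicz φ) {y y' v : ℝ} (hv : 0 ≤ v)
    (hyy' : y ≤ y') : otermDensity φ y v ≤ otermDensity φ y' v := by
  unfold otermDensity
  split_ifs
  · exact le_rfl
  · exact ENNReal.ofReal_le_ofReal (hφ.monotone_rightDeriv (by gcongr))

lemma IsExtOrlicz.lintegral_otermDensity_eq_top {φ : ℝ → ℝ} (hφ : IsExtOrlicz φ) {v : ℝ}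
    (hv : 0 ≤ v) : ∫⁻ y in Ioi 0, otermDensity φ y v = ∞ := by
  have h1 : otermDensity φ 1 v ≠ 0 := by
    intro h
    have hpos := hφ.oterm_pos one_pos hv
    rw [hφ.oterm_eq_lintegral zero_le_one hv] at hpos
    refine hpos.not_ge ((setLIntegral_mono' measurableSet_Ioo fun y hy =>
      hφ.otermDensity_mono hv hy.2.le).trans ?_)
    simp [h]
  refine top_unique ?_
  calc ∞ = ∫⁻ _ in Ioi (1 : ℝ), otermDensity φ 1 v := by simp [ENNReal.mul_top h1]
    _ ≤ ∫⁻ y in Ioi (1 : ℝ), otermDensity φ y v :=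
      setLIntegral_mono' measurableSet_Ioi fun y hy => hφ.otermDensity_mono hv (le_of_lt hy)
    _ ≤ _ := lintegral_mono_set (Ioi_subset_Ioi zero_le_one)

/-! ### Distribution functions and rearrangements -/

lemma measurableSet_Ioa' (a : ℝ≥0∞) : MeasurableSet (Ioa' a) :=
  measurableSet_Ioi.inter (measurableSet_lt ENNReal.measurable_ofReal measurable_const)

lemma volume_pos_ofReal_lt_le (d : ℝ≥0∞) :
    volume {t : ℝ | 0 < t ∧ ENNReal.ofReal t < d} ≤ d := by
  rcases eq_or_ne d ∞ with rfl | hd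
  · exact le_top
  · calc volume {t : ℝ | 0 < t ∧ ENNReal.ofReal t < d} ≤ volume (Ioo 0 d.toReal) := by
          refine measure_mono fun t ht => ⟨ht.1, ?_⟩
          exact (ENNReal.ofReal_lt_iff_lt_toReal ht.1.le hd).1 ht.2
      _ = d := by simp [hd]

lemma distr_antitone (a : ℝ≥0∞) (f : ℝ → ℝ) : Antitone (distr a f) := fun _ _ h =>
  measure_mono fun _ ht => ⟨ht.1, h.trans_lt ht.2⟩

lemma distr_le (a : ℝ≥0∞) (f : ℝ → ℝ) (s : ℝ) : distr a f s ≤ a :=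
  (measure_mono fun _ ht => ht.1).trans (volume_pos_ofReal_lt_le a)

lemma ofReal_lt_distr_of_lt_decRe {a : ℝ≥0∞} {f : ℝ → ℝ} {s t : ℝ} (hs : 0 ≤ s)
    (h : ENNReal.ofReal s < decRe a f t) : ENNReal.ofReal t < distr a f s := by
  contrapose! h
  exact sInf_le ⟨s, ⟨hs, h⟩, rfl⟩

lemma ofReal_le_decRe_of_lt_distr {a : ℝ≥0∞} {f : ℝ → ℝ} {s t : ℝ}
    (h : ENNReal.ofReal t < distr a f s) : ENNReal.ofReal s ≤ decRe a f t := by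
  refine le_sInf ?_
  rintro _ ⟨r, ⟨-, hr⟩, rfl⟩
  refine ENNReal.ofReal_le_ofReal ?_
  by_contra! hrs
  exact (hr.trans_lt h).not_ge (distr_antitone a f hrs.le)

lemma IsExtOrlicz.otermE_decRe_le {φ : ℝ → ℝ} (hφ : IsExtOrlicz φ) (a : ℝ≥0∞) (f : ℝ → ℝ)
    (t : ℝ) {v : ℝ} (hv : 0 ≤ v) :
    otermE φ (decRe a f t) v ≤ ∫⁻ y in Ioi 0,
      {y | ENNReal.ofReal t < distr a f y}.indicator (fun y => otermDensity φ y v) y := by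
  unfold otermE
  split_ifs with hc
  · have h : ∀ y ∈ Ioi (0 : ℝ), {y | ENNReal.ofReal t < distr a f y}.indicator
        (fun y => otermDensity φ y v) y = otermDensity φ y v := fun y hy =>
      indicator_of_mem (s := {y | ENNReal.ofReal t < distr a f y})
        (ofReal_lt_distr_of_lt_decRe (le_of_lt hy) (hc ▸ ENNReal.ofReal_lt_top)) _
    rw [setLIntegral_congr_fun measurableSet_Ioi h, hφ.lintegral_otermDensity_eq_top hv]
  · rw [hφ.oterm_eq_lintegral ENNReal.toReal_nonneg hv]
    have h : ∀ y ∈ Ioo (0 : ℝ) (decRe a f t).toReal, otermDensity φ y v =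
        {y | ENNReal.ofReal t < distr a f y}.indicator (fun y => otermDensity φ y v) y :=
      fun y hy => (indicator_of_mem (s := {y | ENNReal.ofReal t < distr a f y})
        (ofReal_lt_distr_of_lt_decRe hy.1.le ((ENNReal.ofReal_lt_iff_lt_toReal hy.1.le hc).2 hy.2))
        (fun y => otermDensity φ y v)).symm
    rw [setLIntegral_congr_fun measurableSet_Ioo h]
    exact lintegral_mono_set fun y hy => hy.1

/-- Among all measures of given mass dominated by Lebesgue measure on `(0,a)`, the integral of an
increasing function is smallest for Lebesgue measure on an initial interval. -/
lemma setLIntegral_initial_le {a d : ℝ≥0∞} {ν : Measure ℝ} {q : ℝ → ℝ≥0∞}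
    (hq : MonotoneOn q (Ioa' a)) (hν : ν ≤ volume.restrict (Ioa' a)) (hd : d ≠ ∞)
    (hdν : d ≤ ν univ) :
    ∫⁻ t in {t ∈ Ioa' a | ENNReal.ofReal t < d}, q t ≤ ∫⁻ t, q t ∂ν := by
  set S : Set ℝ := {t ∈ Ioa' a | ENNReal.ofReal t < d} with hSdef
  have hS : MeasurableSet S := (measurableSet_Ioa' a).inter
    (measurableSet_lt ENNReal.measurable_ofReal measurable_const)
  have hSd : volume S ≤ d := (measure_mono fun t ht => by exact ⟨ht.1.1, ht.2⟩).trans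
    (volume_pos_ofReal_lt_le d)
  have hνS : ν.restrict S ≤ volume.restrict S :=
    Measure.restrict_mono le_rfl (hν.trans Measure.restrict_le_self)
  have hfin : IsFiniteMeasure (ν.restrict S) :=
    ⟨(hνS univ).trans_lt (by simpa using hSd.trans_lt hd.lt_top)⟩
  have hνSfin : ν S ≠ ∞ := by simpa using measure_ne_top (ν.restrict S) univ
  have hmass : (volume.restrict S - ν.restrict S) univ ≤ ν Sᶜ := by
    rw [Measure.sub_apply MeasurableSet.univ hνS]
    simp only [Measure.restrict_apply_univ]
    refine tsub_le_iff_right.2 ?_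
    rw [add_comm, measure_add_measure_compl hS]
    exact hSd.trans hdν
  have hac : ν ≪ volume.restrict (Ioa' a) := Measure.absolutelyContinuous_of_le hν
  have hI : ∀ᵐ t ∂ν, t ∈ Ioa' a := hac (ae_restrict_mem (measurableSet_Ioa' a))
  set c := ⨆ t ∈ S, q t
  calc ∫⁻ t in S, q t
      = ∫⁻ t, q t ∂(volume.restrict S - ν.restrict S) + ∫⁻ t in S, q t ∂ν := by
        rw [← lintegral_add_measure, Measure.sub_add_cancel_of_le hνS]
    _ ≤ ∫⁻ _, c ∂(volume.restrict S - ν.restrict S) + ∫⁻ t in S, q t ∂ν := by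
        gcongr 1
        refine lintegral_mono_ae ?_
        have : ∀ᵐ t ∂(volume.restrict S), q t ≤ c := by
          filter_upwards [ae_restrict_mem hS] with t ht
          exact le_iSup₂ (f := fun t (_ : t ∈ S) => q t) t ht
        exact (Measure.absolutelyContinuous_of_le Measure.sub_le) this
    _ ≤ c * ν Sᶜ + ∫⁻ t in S, q t ∂ν := by
        rw [lintegral_const]
        gcongr
    _ = ∫⁻ _ in Sᶜ, c ∂ν + ∫⁻ t in S, q t ∂ν := by rw [setLIntegral_const]
    _ ≤ ∫⁻ t in Sᶜ, q t ∂ν + ∫⁻ t in S, q t ∂ν := by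
        gcongr 1
        refine lintegral_mono_ae ?_
        filter_upwards [ae_restrict_mem hS.compl, ae_restrict_of_ae hI] with t ht htI
        refine iSup₂_le fun r hr => hq hr.1 htI ?_
        by_contra! htr
        exact ht ⟨htI, (ENNReal.ofReal_le_ofReal htr.le).trans_lt hr.2⟩
    _ = ∫⁻ t, q t ∂ν := by rw [add_comm, lintegral_add_compl _ hS]

/-- If `π` is a measure on the plane whose first marginal dominates Lebesgue measure on the
superlevel sets of `|k|` and whose second marginal is dominated by Lebesgue measure on `(0,a)`, then
pairing `k` with the weight along `π` does not decrease the modular. -/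
lemma IsExtOrlicz.Mmod_le_lintegral {φ : ℝ → ℝ} (hφ : IsExtOrlicz φ) {a : ℝ≥0∞} {w k : ℝ → ℝ}
    (hw : Measurable w) (hw0 : ∀ t, 0 ≤ w t) (hw_anti : AntitoneOn w (Ioa' a))
    (hk : Measurable k) {π : Measure (ℝ × ℝ)} [SFinite π]
    (hπ : π.map Prod.snd ≤ volume.restrict (Ioa' a))
    (hkπ : ∀ y, 0 < y → distr a k y ≤ π {z | y < |k z.1|})
    (hk_fin : ∀ y, 0 < y → distr a k y ≠ ∞) :
    Mmod a φ w k ≤ ∫⁻ z, oterm φ |k z.1| (w z.2) ∂π := by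
  have hdistr : Measurable (distr a k) := (distr_antitone a k).measurable
  have hdens := hφ.measurable_otermDensity
  have hS : MeasurableSet {z : ℝ × ℝ | ENNReal.ofReal z.1 < distr a k z.2} :=
    measurableSet_lt (ENNReal.measurable_ofReal.comp measurable_fst) (hdistr.comp measurable_snd)
  have hT : MeasurableSet {z : (ℝ × ℝ) × ℝ | z.2 < |k z.1.1|} :=
    measurableSet_lt measurable_snd (by fun_prop)
  have hlevel : ∀ y, MeasurableSet {z : ℝ × ℝ | y < |k z.1|} := fun y =>
    measurableSet_lt measurable_const (by fun_prop)
  calc Mmod a φ w k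
      ≤ ∫⁻ t in Ioa' a, ∫⁻ y in Ioi 0, {y | ENNReal.ofReal t < distr a k y}.indicator
          (fun y => otermDensity φ y (w t)) y :=
        lintegral_mono fun t => hφ.otermE_decRe_le a k t (hw0 t)
    _ = ∫⁻ y in Ioi 0, ∫⁻ t in Ioa' a, {t | ENNReal.ofReal t < distr a k y}.indicator
          (fun t => otermDensity φ y (w t)) t := by
        refine lintegral_lintegral_swap ?_
        exact ((hdens.comp (measurable_snd.prodMk (hw.comp measurable_fst))).indicator
          hS).aemeasurable
    _ ≤ ∫⁻ y in Ioi 0, ∫⁻ z in {z | y < |k z.1|}, otermDensity φ y (w z.2) ∂π := by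
        refine setLIntegral_mono' measurableSet_Ioi fun y hy => ?_
        have hq : Measurable fun t => otermDensity φ y (w t) :=
          hdens.comp (measurable_const.prodMk hw)
        rw [lintegral_indicator (measurableSet_lt ENNReal.measurable_ofReal measurable_const),
          Measure.restrict_restrict
            (measurableSet_lt ENNReal.measurable_ofReal measurable_const), inter_comm,
          ← lintegral_map (μ := π.restrict {z | y < |k z.1|}) hq measurable_snd]
        refine setLIntegral_initial_le (fun s hs t ht hst => ?_) ?_ (hk_fin y hy) ?_
        · exact hφ.otermDensity_anti (le_of_lt hy) (hw0 t) (hw_anti hs ht hst)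
        · exact (Measure.map_mono Measure.restrict_le_self measurable_snd).trans hπ
        · rw [Measure.map_apply measurable_snd MeasurableSet.univ]
          simpa using hkπ y hy
    _ = ∫⁻ z, (∫⁻ y in Ioi 0, {y | y < |k z.1|}.indicator
          (fun y => otermDensity φ y (w z.2)) y) ∂π := by
        rw [lintegral_lintegral_swap]
        · refine lintegral_congr fun y => ?_
          rw [← lintegral_indicator (hlevel y)]
          rfl
        · exact ((hdens.comp (measurable_snd.prodMk
            (hw.comp (measurable_snd.comp measurable_fst)))).indicator hT).aemeasurable
    _ = ∫⁻ z, oterm φ |k z.1| (w z.2) ∂π := by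
        refine lintegral_congr fun z => ?_
        rw [hφ.oterm_eq_lintegral (abs_nonneg _) (hw0 _), show {y | y < |k z.1|} = Iio |k z.1| from rfl,
          lintegral_indicator measurableSet_Iio, Measure.restrict_restrict measurableSet_Iio,
          inter_comm, Ioi_inter_Iio]

/-! ### The rank coupling -/

/-- The dyadic level set `{2^m < |F| ≤ 2^(m+1)}` in `(0,a)`. -/
def levelSet (a : ℝ≥0∞) (F : ℝ → ℝ) (m : ℤ) : Set ℝ :=
  {s ∈ Ioa' a | (2 : ℝ) ^ m < |F s| ∧ |F s| ≤ 2 ^ (m + 1)}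

/-- The interval on which `2^m ≤ F* ≤ 2^(m+1)`. -/
def rankInterval (a : ℝ≥0∞) (F : ℝ → ℝ) (m : ℤ) : Set ℝ :=
  {t ∈ Ioa' a | distr a F (2 ^ (m + 1)) ≤ ENNReal.ofReal t ∧
    ENNReal.ofReal t < distr a F (2 ^ m)}

/-- The measure on `(0,a) × (0,a)` that spreads each dyadic level set of `F` uniformly over the
interval where `F*` takes the corresponding values. -/
def rankCoupling (a : ℝ≥0∞) (F : ℝ → ℝ) : Measure (ℝ × ℝ) :=
  Measure.sum fun m : ℤ => (volume (levelSet a F m))⁻¹ •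
    (volume.restrict (levelSet a F m)).prod (volume.restrict (rankInterval a F m))

instance (a : ℝ≥0∞) (F : ℝ → ℝ) : SFinite (rankCoupling a F) := by
  unfold rankCoupling
  infer_instance

lemma measurableSet_rankInterval (a : ℝ≥0∞) (F : ℝ → ℝ) (m : ℤ) :
    MeasurableSet (rankInterval a F m) :=
  (measurableSet_Ioa' a).inter ((measurableSet_le measurable_const ENNReal.measurable_ofReal).inter
    (measurableSet_lt ENNReal.measurable_ofReal measurable_const))

lemma measurableSet_levelSet (a : ℝ≥0∞) {F : ℝ → ℝ} (hF : Measurable F) (m : ℤ) :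
    MeasurableSet (levelSet a F m) :=
  (measurableSet_Ioa' a).inter ((measurableSet_lt measurable_const hF.abs).inter
    (measurableSet_le hF.abs measurable_const))

lemma pairwise_disjoint_rankInterval (a : ℝ≥0∞) (F : ℝ → ℝ) :
    Pairwise (Function.onFun Disjoint (rankInterval a F)) := by
  refine (pairwise_disjoint_on _).2 fun m n hmn => Set.disjoint_left.2 fun t hm hn => ?_
  refine (hm.2.1.trans_lt hn.2.2).not_ge (distr_antitone a F ?_)
  exact zpow_le_zpow_right₀ one_le_two (by lia)

lemma pairwise_disjoint_levelSet (a : ℝ≥0∞) (F : ℝ → ℝ) :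
    Pairwise (Function.onFun Disjoint (levelSet a F)) := by
  refine (pairwise_disjoint_on _).2 fun m n hmn => Set.disjoint_left.2 fun t hm hn => ?_
  refine (hn.2.1.trans_le hm.2.2).not_ge ?_
  exact zpow_le_zpow_right₀ one_le_two (by lia)

lemma exists_mem_levelSet {a : ℝ≥0∞} {F : ℝ → ℝ} {s : ℝ} (hs : s ∈ Ioa' a) (hF : F s ≠ 0) :
    ∃ m, s ∈ levelSet a F m := by
  obtain ⟨m, hm⟩ := exists_mem_Ioc_zpow (abs_pos.2 hF) one_lt_two
  exact ⟨m, hs, hm⟩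

lemma volume_levelSet_le (a : ℝ≥0∞) {F : ℝ → ℝ} (hF : Measurable F)
    (hfin : ∀ y, 0 < y → distr a F y ≠ ∞) (m : ℤ) :
    volume (levelSet a F m) ≤ volume (rankInterval a F m) := by
  have h0 : (0 : ℝ) < 2 ^ m := by positivity
  have h1 : (0 : ℝ) < 2 ^ (m + 1) := by positivity
  have hle : (2 : ℝ) ^ m ≤ 2 ^ (m + 1) := zpow_le_zpow_right₀ one_le_two (by lia)
  have hdiff : levelSet a F m =
      {t ∈ Ioa' a | 2 ^ m < |F t|} \ {t ∈ Ioa' a | 2 ^ (m + 1) < |F t|} := by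
    ext t
    simp only [levelSet, Set.mem_sdiff, mem_ofPred_eq, not_and, not_lt]
    tauto
  have hsub : Ioo (distr a F (2 ^ (m + 1))).toReal (distr a F (2 ^ m)).toReal ⊆
      rankInterval a F m := by
    intro t ht
    have ht0 : 0 < t := ENNReal.toReal_nonneg.trans_lt ht.1
    have ht2 := (ENNReal.ofReal_lt_iff_lt_toReal ht0.le (hfin _ h0)).2 ht.2
    exact ⟨⟨ht0, ht2.trans_le (distr_le a F _)⟩,
      (ENNReal.le_ofReal_iff_toReal_le (hfin _ h1) ht0.le).2 ht.1.le, ht2⟩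
  refine le_trans ?_ (measure_mono hsub)
  have hmeas : MeasurableSet {t ∈ Ioa' a | 2 ^ (m + 1) < |F t|} :=
    (measurableSet_Ioa' a).inter (measurableSet_lt measurable_const hF.abs)
  have hanti : {t ∈ Ioa' a | 2 ^ (m + 1) < |F t|} ⊆ {t ∈ Ioa' a | 2 ^ m < |F t|} :=
    fun t ht => ⟨ht.1, hle.trans_lt ht.2⟩
  rw [hdiff, measure_sdiff hanti hmeas.nullMeasurableSet
    (hfin _ h1), Real.volume_Ioo, ENNReal.ofReal_sub _ ENNReal.toReal_nonneg,
    ENNReal.ofReal_toReal (hfin _ h0), ENNReal.ofReal_toReal (hfin _ h1)]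
  rfl

lemma volume_levelSet_ne_top {a : ℝ≥0∞} {F : ℝ → ℝ}
    (hfin : ∀ y, 0 < y → distr a F y ≠ ∞) (m : ℤ) : volume (levelSet a F m) ≠ ∞ :=
  ne_top_of_le_ne_top (hfin (2 ^ m) (by positivity)) (measure_mono fun _ ht => ⟨ht.1, ht.2.1⟩)

lemma map_snd_rankCoupling_le (a : ℝ≥0∞) (F : ℝ → ℝ) :
    (rankCoupling a F).map Prod.snd ≤ volume.restrict (Ioa' a) := by
  refine Measure.le_iff.2 fun B hB => ?_
  rw [Measure.map_apply measurable_snd hB, rankCoupling,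
    Measure.sum_apply _ (measurable_snd hB), Measure.restrict_apply hB]
  calc ∑' m : ℤ, ((volume (levelSet a F m))⁻¹ • (volume.restrict (levelSet a F m)).prod
        (volume.restrict (rankInterval a F m))) (Prod.snd ⁻¹' B)
      ≤ ∑' m : ℤ, volume (B ∩ rankInterval a F m) := by
        refine ENNReal.tsum_le_tsum fun m => ?_
        rw [Measure.smul_apply, smul_eq_mul, ← univ_prod, Measure.prod_prod,
          Measure.restrict_apply_univ, Measure.restrict_apply hB, ← mul_assoc]
        exact mul_le_of_le_one_left' (ENNReal.inv_mul_le_one _)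
    _ = volume (⋃ m, B ∩ rankInterval a F m) :=
        (measure_iUnion (fun m n hmn => (pairwise_disjoint_rankInterval a F hmn).mono
          inter_subset_right inter_subset_right)
          fun m => hB.inter (measurableSet_rankInterval a F m)).symm
    _ ≤ volume (B ∩ Ioa' a) :=
        measure_mono (iUnion_subset fun m => inter_subset_inter_right B fun t ht => ht.1)

lemma volume_le_rankCoupling {a : ℝ≥0∞} {F : ℝ → ℝ} (hF : Measurable F)
    (hfin : ∀ y, 0 < y → distr a F y ≠ ∞) {X : Set ℝ} (hX : MeasurableSet X)
    (hXF : ∀ s ∈ X, F s ≠ 0) :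
    volume (Ioa' a ∩ X) ≤ rankCoupling a F (Prod.fst ⁻¹' X) := by
  rw [rankCoupling, Measure.sum_apply _ (measurable_fst hX)]
  calc volume (Ioa' a ∩ X) ≤ volume (⋃ m, X ∩ levelSet a F m) := by
        refine measure_mono fun s hs => ?_
        obtain ⟨m, hm⟩ := exists_mem_levelSet hs.1 (hXF s hs.2)
        exact mem_iUnion.2 ⟨m, hs.2, hm⟩
    _ ≤ ∑' m, volume (X ∩ levelSet a F m) := measure_iUnion_le _
    _ ≤ _ := by
        refine ENNReal.tsum_le_tsum fun m => ?_
        rw [Measure.smul_apply, smul_eq_mul, ← prod_univ, Measure.prod_prod,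
          Measure.restrict_apply_univ, Measure.restrict_apply hX]
        rcases eq_or_ne (volume (levelSet a F m)) 0 with h0 | h0
        · simp [measure_mono_null inter_subset_right h0]
        · calc volume (X ∩ levelSet a F m)
              = (volume (levelSet a F m))⁻¹ *
                  (volume (X ∩ levelSet a F m) * volume (levelSet a F m)) := by
                rw [mul_comm (volume _) (volume (levelSet a F m)), ← mul_assoc,
                  ENNReal.inv_mul_cancel h0 (volume_levelSet_ne_top hfin m), one_mul]
            _ ≤ _ := by
                gcongr _ * (_ * ?_)
                exact volume_levelSet_le a hF hfin m

lemma IsExtOrlicz.lintegral_rankCoupling_le {φ : ℝ → ℝ} (hφ : IsExtOrlicz φ) {a : ℝ≥0∞}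
    {w F : ℝ → ℝ} (hw0 : ∀ t, 0 ≤ w t) (hw : Measurable w) (hF : Measurable F) :
    ∫⁻ z, oterm φ (|F z.1| / 2) (w z.2) ∂(rankCoupling a F) ≤ Mmod a φ w F := by
  have hmeas : Measurable fun z : ℝ × ℝ => oterm φ (|F z.1| / 2) (w z.2) :=
    hφ.measurable_oterm.comp (by fun_prop : Measurable fun z : ℝ × ℝ => (|F z.1| / 2, w z.2))
  rw [rankCoupling, lintegral_sum_measure]
  calc ∑' m : ℤ, ∫⁻ z, oterm φ (|F z.1| / 2) (w z.2) ∂((volume (levelSet a F m))⁻¹ •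
        (volume.restrict (levelSet a F m)).prod (volume.restrict (rankInterval a F m)))
      ≤ ∑' m : ℤ, ∫⁻ t in rankInterval a F m, otermE φ (decRe a F t) (w t) := by
        refine ENNReal.tsum_le_tsum fun m => ?_
        rw [lintegral_smul_measure, lintegral_prod _ hmeas.aemeasurable]
        calc (volume (levelSet a F m))⁻¹ • ∫⁻ s in levelSet a F m, ∫⁻ t in rankInterval a F m,
              oterm φ (|F s| / 2) (w t)
            ≤ (volume (levelSet a F m))⁻¹ • ∫⁻ _ in levelSet a F m,
              ∫⁻ t in rankInterval a F m, otermE φ (decRe a F t) (w t) := by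
              simp only [smul_eq_mul]
              gcongr 1
              refine setLIntegral_mono' (measurableSet_levelSet a hF m) fun s hs =>
                setLIntegral_mono' (measurableSet_rankInterval a F m) fun t ht => ?_
              refine hφ.oterm_le_otermE (by positivity) ?_ (hw0 t)
              refine le_trans (ENNReal.ofReal_le_ofReal ?_) (ofReal_le_decRe_of_lt_distr ht.2.2)
              have := hs.2.2
              rw [zpow_add_one₀ two_ne_zero] at this
              linarith
          _ ≤ _ := by
              rw [setLIntegral_const, smul_eq_mul, mul_comm _ (volume _), ← mul_assoc]
              exact mul_le_of_le_one_left' (ENNReal.inv_mul_le_one _)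
    _ = ∫⁻ t in ⋃ m, rankInterval a F m, otermE φ (decRe a F t) (w t) :=
        (lintegral_iUnion (measurableSet_rankInterval a F) (pairwise_disjoint_rankInterval a F)
          _).symm
    _ ≤ Mmod a φ w F := lintegral_mono_set (iUnion_subset fun m t ht => ht.1)

/-- Functions of finite modular have finite distribution functions. -/
lemma IsExtOrlicz.distr_ne_top {φ : ℝ → ℝ} (hφ : IsExtOrlicz φ) {a : ℝ≥0∞} {w F : ℝ → ℝ}
    (hw0 : ∀ t, 0 ≤ w t) (hw_anti : AntitoneOn w (Ioa' a)) (hM : Mmod a φ w F ≠ ∞) {y : ℝ}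
    (hy : 0 < y) : distr a F y ≠ ∞ := by
  intro hd
  have ha : a = ∞ := top_unique (hd ▸ distr_le a F y)
  have hI : Ioi (1 : ℝ) ⊆ Ioa' a := fun t ht =>
    ⟨zero_lt_one.trans ht, by simp [ha]⟩
  have h1 : (1 : ℝ) ∈ Ioa' a := ⟨one_pos, by simp [ha]⟩
  refine hM (top_unique ?_)
  calc ∞ = ∫⁻ _ in Ioi (1 : ℝ), oterm φ y (w 1) := by
        simp [ENNReal.mul_top (hφ.oterm_pos hy (hw0 1)).ne']
    _ ≤ ∫⁻ t in Ioi (1 : ℝ), otermE φ (decRe a F t) (w t) := by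
        refine setLIntegral_mono' measurableSet_Ioi fun t ht => ?_
        refine (hφ.oterm_mono hy.le le_rfl (hw0 t) (hw_anti h1 (hI ht) (le_of_lt ht))).trans ?_
        exact hφ.oterm_le_otermE hy.le
          (ofReal_le_decRe_of_lt_distr (hd ▸ ENNReal.ofReal_lt_top)) (hw0 t)
    _ ≤ Mmod a φ w F := lintegral_mono_set hI

lemma IsExtOrlicz.Mmod_le_lintegral_rankCoupling {φ : ℝ → ℝ} (hφ : IsExtOrlicz φ) {a : ℝ≥0∞}
    {w F k : ℝ → ℝ} (hw : Measurable w) (hw0 : ∀ t, 0 ≤ w t) (hw_anti : AntitoneOn w (Ioa' a))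
    (hF : Measurable F) (hM : Mmod a φ w F ≠ ∞) (hk : Measurable k) {c : ℝ} (hc : 0 < c)
    (hkF : ∀ t, |k t| ≤ c * |F t|) :
    Mmod a φ w k ≤ ∫⁻ z, oterm φ |k z.1| (w z.2) ∂(rankCoupling a F) := by
  have hfin : ∀ y, 0 < y → distr a F y ≠ ∞ := fun y => hφ.distr_ne_top hw0 hw_anti hM
  refine hφ.Mmod_le_lintegral hw hw0 hw_anti hk (map_snd_rankCoupling_le a F) (fun y hy => ?_)
    fun y hy => ?_
  · refine volume_le_rankCoupling hF hfin (X := {t | y < |k t|})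
      (measurableSet_lt measurable_const hk.abs) fun s hs h0 => ?_
    have h := hy.trans (lt_of_lt_of_le hs (hkF s))
    simp [h0] at h
  · refine ne_top_of_le_ne_top (hfin (y / c) (by positivity)) (measure_mono fun t ht => ⟨ht.1, ?_⟩)
    rw [div_lt_iff₀' hc]
    exact ht.2.trans_le (hkF t)

/-! ### Concavity of the integrand and the main estimate -/

/-- A function that is, up to a constant `C` in the argument, of the form `t ↦ η (t ^ p)` with `η`
concave satisfies a Jensen-type inequality with loss `C ^ 2`. -/
lemma IsExtOrlicz.sum_mul_oterm_le {φ ψ : ℝ → ℝ} (hφ : IsExtOrlicz φ) (hψ : IsExtOrlicz ψ)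
    {p C : ℝ} (hp : 0 < p) (hC : 0 < C)
    (hconc : ConcaveOn ℝ (Ici 0) fun t : ℝ => ψ (t ^ (1 / p)))
    (hψφ : ∀ t, 0 ≤ t → ψ (C⁻¹ * t) ≤ φ t ∧ φ t ≤ ψ (C * t))
    {ι : Type*} [Fintype ι] {x e : ι → ℝ} (hx : ∀ i, 0 ≤ x i) (he : ∀ i, 0 ≤ e i)
    (hE : 0 < ∑ i, e i ^ p) {v : ℝ} (hv : 0 ≤ v) :
    ∑ i, ENNReal.ofReal (e i ^ p / ∑ j, e j ^ p) * oterm φ (x i / e i) v ≤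
      oterm φ (C ^ 2 * ((∑ i, x i ^ p) ^ (1 / p) / (∑ i, e i ^ p) ^ (1 / p))) v := by
  set E := ∑ i, e i ^ p
  set S := ∑ i, x i ^ p
  have hS : 0 ≤ S := Finset.sum_nonneg fun i _ => Real.rpow_nonneg (hx i) p
  rcases hv.eq_or_lt with rfl | hv
  · by_cases h0 : ∀ i, x i = 0
    · simp [h0, oterm]
    · push Not at h0
      obtain ⟨j, hj⟩ := h0
      have hSpos : 0 < S := Finset.sum_pos' (fun i _ => Real.rpow_nonneg (hx i) p)
        ⟨j, Finset.mem_univ j, Real.rpow_pos_of_pos ((hx j).lt_of_ne' hj) p⟩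
      have hne : C ^ 2 * (S ^ (1 / p) / E ^ (1 / p)) ≠ 0 := by positivity
      rw [oterm, if_pos rfl, if_neg hne]
      exact le_top
  · have hterm : ∀ i, 0 ≤ φ (x i / e i / v) * v := fun i =>
      mul_nonneg (hφ.nonneg (div_nonneg (div_nonneg (hx i) (he i)) hv.le)) hv.le
    have hθ : ∀ i, 0 ≤ e i ^ p / E := fun i => div_nonneg (Real.rpow_nonneg (he i) p) hE.le
    have hθ1 : ∑ i, e i ^ p / E = 1 := by rw [← Finset.sum_div, div_self hE.ne']
    have hy : ∀ i, 0 ≤ C * (x i / e i / v) := fun i =>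
      mul_nonneg hC.le (div_nonneg (div_nonneg (hx i) (he i)) hv.le)
    have hroot : ∀ y : ℝ, 0 ≤ y → (y ^ p) ^ (1 / p) = y := fun y hy => by
      rw [← Real.rpow_mul hy, mul_one_div_cancel hp.ne', Real.rpow_one]
    have hsum : ∑ i, (e i ^ p / E) * (C * (x i / e i / v)) ^ p ≤ (C / v) ^ p * (S / E) := by
      rw [Finset.sum_div, Finset.mul_sum]
      refine Finset.sum_le_sum fun i _ => ?_
      have hrw : C * (x i / e i / v) = C / v * (x i / e i) := by ring
      rw [hrw, Real.mul_rpow (by positivity) (div_nonneg (hx i) (he i)),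
        Real.div_rpow (hx i) (he i)]
      have hxp := Real.rpow_nonneg (hx i) p
      rcases eq_or_ne (e i ^ p) 0 with h0 | h0
      · rw [h0, zero_div, zero_mul]
        positivity
      · exact le_of_eq (by field_simp)
    have hkey : ∑ i, (e i ^ p / E) * φ (x i / e i / v) ≤
        φ (C ^ 2 * (S ^ (1 / p) / E ^ (1 / p)) / v) := by
      calc ∑ i, (e i ^ p / E) * φ (x i / e i / v)
          ≤ ∑ i, (e i ^ p / E) * ψ (((C * (x i / e i / v)) ^ p) ^ (1 / p)) := by
            refine Finset.sum_le_sum fun i _ => mul_le_mul_of_nonneg_left ?_ (hθ i)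
            rw [hroot _ (hy i)]
            exact (hψφ _ (div_nonneg (div_nonneg (hx i) (he i)) hv.le)).2
        _ ≤ ψ ((∑ i, (e i ^ p / E) * (C * (x i / e i / v)) ^ p) ^ (1 / p)) := by
            simpa using hconc.le_map_sum (fun i _ => hθ i) hθ1
              fun i _ => mem_Ici.2 (Real.rpow_nonneg (hy i) p)
        _ ≤ ψ (((C / v) ^ p * (S / E)) ^ (1 / p)) := by
            refine hψ.monotone (Real.rpow_le_rpow ?_ hsum (by positivity))
            exact Finset.sum_nonneg fun i _ => mul_nonneg (hθ i) (Real.rpow_nonneg (hy i) p)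
        _ = ψ (C⁻¹ * (C ^ 2 * (S ^ (1 / p) / E ^ (1 / p)) / v)) := by
            rw [Real.mul_rpow (by positivity) (by positivity), hroot _ (by positivity),
              Real.div_rpow hS hE.le]
            congr 1
            field_simp
        _ ≤ _ := (hψφ _ (by positivity)).1
    simp only [oterm, hv.ne', if_false]
    rw [Finset.sum_congr rfl fun i _ => (ENNReal.ofReal_mul (hθ i)).symm,
      ← ENNReal.ofReal_sum_of_nonneg fun i _ => mul_nonneg (hθ i) (hterm i)]
    refine ENNReal.ofReal_le_ofReal ?_
    simp_rw [← mul_assoc, ← Finset.sum_mul]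
    exact mul_le_mul_of_nonneg_right hkey hv.le

lemma Mnorm_le_ofReal {a : ℝ≥0∞} {φ w f : ℝ → ℝ} {e : ℝ} (he : 0 < e)
    (h : Mmod a φ w (fun t => f t / e) ≤ 1) : Mnorm a φ w f ≤ ENNReal.ofReal e :=
  iInf₂_le e ⟨he, h⟩

lemma IsExtOrlicz.sum_Mnorm_rpow_le {φ ψ : ℝ → ℝ} (hφ : IsExtOrlicz φ) (hψ : IsExtOrlicz ψ)
    {p C : ℝ} (hp : 0 < p) (hC : 0 < C)
    (hconc : ConcaveOn ℝ (Ici 0) fun t : ℝ => ψ (t ^ (1 / p)))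
    (hψφ : ∀ t, 0 ≤ t → ψ (C⁻¹ * t) ≤ φ t ∧ φ t ≤ ψ (C * t))
    {a : ℝ≥0∞} {w : ℝ → ℝ} (hw : Measurable w) (hw0 : ∀ t, 0 ≤ w t)
    (hw_anti : AntitoneOn w (Ioa' a)) {ι : Type*} [Fintype ι] {f : ι → ℝ → ℝ}
    (hf : ∀ i, Measurable (f i)) {ε : ℝ} (hε : 0 < ε)
    (hM : Mmod a φ w (fun t => (∑ i, |f i t| ^ p) ^ (1 / p) / ε) ≤ 1) :
    ∑ i, Mnorm a φ w (f i) ^ p ≤ ENNReal.ofReal (4 * C ^ 2 * ε) ^ p := by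
  set G : ℝ → ℝ := fun t => (∑ i, |f i t| ^ p) ^ (1 / p) with hG
  set F : ℝ → ℝ := fun t => G t / ε with hFdef
  have hGm : Measurable G := by
    refine (Finset.measurable_sum _ fun i _ => ?_).pow_const _
    exact (hf i).abs.pow_const p
  have hF : Measurable F := hGm.div_const ε
  have hG0 : ∀ t, 0 ≤ G t := fun t =>
    Real.rpow_nonneg (Finset.sum_nonneg fun i _ => Real.rpow_nonneg (abs_nonneg _) p) _
  have hfG : ∀ i t, |f i t| ≤ G t := fun i t => by
    have h := Finset.single_le_sum (f := fun i => |f i t| ^ p)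
      (fun i _ => Real.rpow_nonneg (abs_nonneg _) p) (Finset.mem_univ i)
    calc |f i t| = (|f i t| ^ p) ^ (1 / p) := by
          rw [← Real.rpow_mul (abs_nonneg _), mul_one_div_cancel hp.ne', Real.rpow_one]
      _ ≤ G t := Real.rpow_le_rpow (by positivity) h (by positivity)
  have hbound : ∫⁻ z, oterm φ (G z.1 / (2 * ε)) (w z.2) ∂(rankCoupling a F) ≤ 1 := by
    refine le_trans (le_of_eq ?_) ((hφ.lintegral_rankCoupling_le hw0 hw hF).trans hM)
    refine lintegral_congr fun z => ?_
    rw [hFdef, abs_of_nonneg (div_nonneg (hG0 _) hε.le), div_div, mul_comm ε]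
  have hcompare : ∀ i, ∀ e : ℝ, 0 < e → Mmod a φ w (fun t => f i t / e) ≤
      ∫⁻ z, oterm φ (|f i z.1| / e) (w z.2) ∂(rankCoupling a F) := fun i e he => by
    have h := hφ.Mmod_le_lintegral_rankCoupling (k := fun t => f i t / e) hw hw0 hw_anti hF
      (ne_top_of_le_ne_top one_ne_top hM) ((hf i).div_const e) (c := ε / e) (by positivity)
      fun t => by
        rw [hFdef, abs_of_nonneg (div_nonneg (hG0 _) hε.le), abs_div, abs_of_pos he]
        have := hfG i t
        field_simp
        exact this
    simpa only [abs_div, abs_of_pos he] using h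
  have hNfin : ∀ i, Mnorm a φ w (f i) ≠ ∞ := fun i => by
    refine ne_top_of_le_ne_top ENNReal.ofReal_ne_top
      (Mnorm_le_ofReal (e := 2 * ε) (by positivity) ((hcompare i _ (by positivity)).trans ?_))
    refine (lintegral_mono fun z => hφ.oterm_mono (by positivity) ?_ (hw0 _) le_rfl).trans hbound
    exact div_le_div_of_nonneg_right (hfG i z.1) (by positivity)
  by_contra! hlt
  set e : ι → ℝ := fun i => (Mnorm a φ w (f i)).toReal / 2 with hedef
  have he : ∀ i, 0 ≤ e i := fun i => by positivity
  have hN : ∀ i, Mnorm a φ w (f i) = ENNReal.ofReal (2 * e i) := fun i => by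
    rw [hedef, mul_div_cancel₀ _ two_ne_zero, ENNReal.ofReal_toReal (hNfin i)]
  set E := ∑ i, e i ^ p with hEdef
  have hElt : (2 * C ^ 2 * ε) ^ p < E := by
    simp_rw [hN] at hlt
    rw [ENNReal.ofReal_rpow_of_nonneg (by positivity) hp.le,
      Finset.sum_congr rfl fun i _ => ENNReal.ofReal_rpow_of_nonneg
        (mul_nonneg zero_le_two (he i)) hp.le, ← ENNReal.ofReal_sum_of_nonneg fun i _ =>
        Real.rpow_nonneg (mul_nonneg zero_le_two (he i)) p] at hlt
    have h := (ENNReal.ofReal_lt_ofReal_iff_of_nonneg (by positivity)).1 hlt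
    simp_rw [fun i => Real.mul_rpow (zero_le_two (α := ℝ)) (he i) (z := p)] at h
    rw [← Finset.mul_sum, show 4 * C ^ 2 * ε = 2 * (2 * C ^ 2 * ε) by ring,
      Real.mul_rpow zero_le_two (by positivity)] at h
    exact lt_of_mul_lt_mul_left h (by positivity)
  have hE : 0 < E := lt_of_le_of_lt (by positivity) hElt
  have hroot : 2 * C ^ 2 * ε ≤ E ^ (1 / p) := by
    rw [one_div, Real.le_rpow_inv_iff_of_pos (by positivity) hE.le hp]
    exact hElt.le
  have hgt : ∀ i, 0 < e i →
      1 < ∫⁻ z, oterm φ (|f i z.1| / e i) (w z.2) ∂(rankCoupling a F) := fun i hi => by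
    refine lt_of_lt_of_le ?_ (hcompare i (e i) hi)
    by_contra! h
    have h2 := Mnorm_le_ofReal hi h
    rw [hN, ENNReal.ofReal_le_ofReal_iff hi.le] at h2
    linarith
  have hmeas : ∀ i, Measurable fun z : ℝ × ℝ => oterm φ (|f i z.1| / e i) (w z.2) := fun i =>
    hφ.measurable_oterm.comp ((((hf i).comp measurable_fst).abs.div_const _).prodMk
      (hw.comp measurable_snd))
  have hle : ∑ i, ENNReal.ofReal (e i ^ p / E) *
      ∫⁻ z, oterm φ (|f i z.1| / e i) (w z.2) ∂(rankCoupling a F) ≤ 1 := by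
    simp_rw [← fun i => lintegral_const_mul (μ := rankCoupling a F)
      (ENNReal.ofReal (e i ^ p / E)) (hmeas i)]
    rw [← lintegral_finsetSum _ fun i _ => (hmeas i).const_mul _]
    refine (lintegral_mono fun z => ?_).trans hbound
    refine (hφ.sum_mul_oterm_le hψ hp hC hconc hψφ (fun i => abs_nonneg (f i z.1)) he hE
      (hw0 z.2)).trans (hφ.oterm_mono ?_ ?_ (hw0 _) le_rfl)
    · have := hG0 z.1
      positivity
    · change C ^ 2 * (G z.1 / E ^ (1 / p)) ≤ G z.1 / (2 * ε)
      have := hG0 z.1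
      calc C ^ 2 * (G z.1 / E ^ (1 / p)) ≤ C ^ 2 * (G z.1 / (2 * C ^ 2 * ε)) := by gcongr
        _ = G z.1 / (2 * ε) := by field_simp
  have hθ1 : ∑ i, ENNReal.ofReal (e i ^ p / E) = 1 := by
    rw [← ENNReal.ofReal_sum_of_nonneg fun i _ => div_nonneg (Real.rpow_nonneg (he i) p) hE.le,
      ← Finset.sum_div, div_self hE.ne', ENNReal.ofReal_one]
  have hpos : ∀ i, ENNReal.ofReal (e i ^ p / E) ≠ 0 → 0 < e i := fun i hi => by
    refine (he i).lt_of_ne' fun h0 => hi ?_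
    rw [h0, Real.zero_rpow hp.ne', zero_div, ENNReal.ofReal_zero]
  refine hle.not_gt ?_
  calc 1 = ∑ i with 0 < e i, ENNReal.ofReal (e i ^ p / E) := by
        rw [Finset.sum_filter_of_ne fun i _ => hpos i, hθ1]
    _ < ∑ i with 0 < e i, ENNReal.ofReal (e i ^ p / E) *
          ∫⁻ z, oterm φ (|f i z.1| / e i) (w z.2) ∂(rankCoupling a F) := by
        refine ENNReal.sum_lt_sum_of_nonempty ?_ fun i hi => ?_
        · obtain ⟨j, -, hj⟩ := Finset.exists_ne_zero_of_sum_ne_zero (hθ1.trans_ne one_ne_zero)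
          exact ⟨j, Finset.mem_filter.2 ⟨Finset.mem_univ j, hpos j hj⟩⟩
        · have hi' : 0 < e i := (Finset.mem_filter.1 hi).2
          have hθ : ENNReal.ofReal (e i ^ p / E) ≠ 0 :=
            (ENNReal.ofReal_pos.2 (div_pos (Real.rpow_pos_of_pos hi' p) hE)).ne'
          simpa using ENNReal.mul_lt_mul_right hθ ENNReal.ofReal_ne_top (hgt i hi')
    _ ≤ _ := Finset.sum_le_univ_sum_of_nonneg fun _ => zero_le

lemma Mmod_congr {a : ℝ≥0∞} {φ φ' w w' : ℝ → ℝ} (hφ : ∀ x, 0 ≤ x → φ x = φ' x)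
    (hw0 : ∀ t ∈ Ioa' a, 0 ≤ w t) (hw : ∀ t ∈ Ioa' a, w t = w' t) (f : ℝ → ℝ) :
    Mmod a φ w f = Mmod a φ' w' f := by
  refine setLIntegral_congr_fun (measurableSet_Ioa' a) fun t ht => ?_
  simp only [otermE, oterm, ← hw t ht, hφ _ (div_nonneg ENNReal.toReal_nonneg (hw0 t ht))]

/-- if `φ` is equivalent to a `p`-concave Orlicz function, `1 < p < ∞`,
then the class `M_{φ,w}` is `p`-concave: for some `c > 0`,
`‖(∑|fᵢ|^p)^{1/p}‖_M ≥ c (∑‖fᵢ‖_M^p)^{1/p}`. -/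
theorem statement13 (a : ℝ≥0∞) (ha : 0 < a)
    (w : ℝ → ℝ) (hw_meas : Measurable w) (hw_nonneg : ∀ t ∈ Ioa' a, 0 ≤ w t)
    (hw_dec : ∀ s ∈ Ioa' a, ∀ t ∈ Ioa' a, s ≤ t → w t ≤ w s)
    (φ : ℝ → ℝ) (hφ : IsOrliczFn φ) (p : ℝ) (hp : 1 < p)
    (hequiv : ∃ ψ : ℝ → ℝ, IsOrliczFn ψ ∧
      ConcaveOn ℝ (Set.Ici 0) (fun t : ℝ => ψ (t ^ (1 / p))) ∧
      ∃ C > 0, ∀ t ≥ (0:ℝ), ψ (C⁻¹ * t) ≤ φ t ∧ φ t ≤ ψ (C * t)) :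
    ∃ c > 0, ∀ n : ℕ, ∀ f : Fin n → ℝ → ℝ, (∀ i, f i ∈ Mclass a φ w) →
      ENNReal.ofReal c * (∑ i, Mnorm a φ w (f i) ^ p) ^ (1 / p) ≤
        Mnorm a φ w (fun t => (∑ i, |f i t| ^ p) ^ (1 / p)) := by
  obtain ⟨ψ, hψ, hconc, C, hC, hψφ⟩ := hequiv
  have hp0 : 0 < p := zero_lt_one.trans hp
  have hext : ∀ (χ : ℝ → ℝ) (x : ℝ), 0 ≤ x → χ x = χ (max x 0) := fun χ x hx => by
    rw [max_eq_left hx]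
  have hw0 : ∀ t, 0 ≤ max (w t) 0 := fun t => le_max_right _ _
  have hw_anti : AntitoneOn (fun t => max (w t) 0) (Ioa' a) := fun s hs t ht hst =>
    max_le_max_right 0 (hw_dec s hs t ht hst)
  have hconc' : ConcaveOn ℝ (Ici 0) fun t : ℝ => ψ (max (t ^ (1 / p)) 0) :=
    hconc.congr fun t ht => hext ψ _ (Real.rpow_nonneg ht _)
  have hψφ' : ∀ t, 0 ≤ t →
      ψ (max (C⁻¹ * t) 0) ≤ φ (max t 0) ∧ φ (max t 0) ≤ ψ (max (C * t) 0) := fun t ht => by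
    rw [← hext ψ _ (by positivity), ← hext ψ _ (by positivity), ← hext φ _ ht]
    exact hψφ t ht
  have hM : Mmod a φ w = Mmod a (fun x => φ (max x 0)) fun t => max (w t) 0 :=
    funext (Mmod_congr (hext φ) hw_nonneg fun t ht => (max_eq_left (hw_nonneg t ht)).symm)
  have hN : Mnorm a φ w = Mnorm a (fun x => φ (max x 0)) fun t => max (w t) 0 := by
    unfold Mnorm
    rw [hM]
  refine ⟨(4 * C ^ 2)⁻¹, by positivity, fun n f hf => le_iInf₂ fun ε hε => ?_⟩
  obtain ⟨hε0, hε1⟩ := hε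
  rw [hM] at hε1
  have hsum := hφ.isExtOrlicz.sum_Mnorm_rpow_le hψ.isExtOrlicz hp0 hC hconc' hψφ'
    (hw_meas.max measurable_const) hw0 hw_anti (fun i => (hf i).1) hε0 hε1
  rw [← hN] at hsum
  calc ENNReal.ofReal (4 * C ^ 2)⁻¹ * (∑ i, Mnorm a φ w (f i) ^ p) ^ (1 / p)
      ≤ ENNReal.ofReal (4 * C ^ 2)⁻¹ * (ENNReal.ofReal (4 * C ^ 2 * ε) ^ p) ^ (1 / p) := by
        gcongr
    _ = ENNReal.ofReal ε := by
        rw [← ENNReal.rpow_mul, mul_one_div_cancel hp0.ne', ENNReal.rpow_one,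
          ← ENNReal.ofReal_mul (by positivity), inv_mul_cancel_left₀ (by positivity)]

end OrliczRearrangement

end
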